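/- arXiv:2601.06745 — 2 statements merged into one kernel-verified Lean document; each statement's English description precedes it below -/
import Mathlib

section
/- Let N ≥ 2 and let M₁,…,M_N be closed proper subspaces of a complex Hilbert space H, with M = ⋂_{i=1}^N M_i. Then the following two assertions are equivalent: (1) there exist a permutation ρ of {1,…,N} and weights (w₁,…,w_N) ∈ 𝒮_N such that at least one of the following holds: 1 ∉ σ(P_{M_{ρ(1)}}⋯P_{M_{ρ(N)}} − P_M), or ‖P_{M_{ρ(1)}}⋯P_{M_{ρ(N)}} − P_M‖ < 1, or ‖∑_{i=1}^N w_i P_{M_i} − P_M‖ < 1; (2) for every permutation ρ' of {1,…,N} and every (w'₁,…,w'_N) ∈ 𝒮_N, all three of the following hold: 1 ∉ σ(P_{M_{ρ'(1)}}⋯P_{M_{ρ'(N)}} − P_M), and ‖P_{M_{ρ'(1)}}⋯P_{M_{ρ'(N)}} − P_M‖ < 1, and ‖∑_{i=1}^N w'_i P_{M_i} − P_M‖ < 1. -/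
open scoped ENNReal
set_option linter.unusedSectionVars false

variable {H : Type*} [NormedAddCommGroup H] [InnerProductSpace ℂ H] [CompleteSpace H]

/-- The orthogonal projection onto a closed subspace, as an operator on the ambient space. -/
noncomputable def proj (S : Submodule ℂ H) (hS : IsClosed (S : Set H)) : H →L[ℂ] H :=
  haveI : CompleteSpace S := hS.completeSpace_coe
  S.subtypeL.comp (Submodule.orthogonalProjectionOnto S)

lemma isClosed_iInf {ι : Sort*} {S : ι → Submodule ℂ H} (h : ∀ i, IsClosed ((S i : Set H))) :
    IsClosed ((⨅ i, S i : Submodule ℂ H) : Set H) := by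
  rw [Submodule.coe_iInf]
  exact isClosed_iInter h

/-- The metric properties of orthogonal projections that the proof uses. -/
structure IsPr (T : H →L[ℂ] H) : Prop where
  pyth : ∀ x, ‖T x‖ ^ 2 + ‖x - T x‖ ^ 2 = ‖x‖ ^ 2
  idem : ∀ x, T (T x) = T x

lemma proj_mem (S : Submodule ℂ H) (hS : IsClosed (S : Set H)) (x : H) : proj S hS x ∈ S := by
  simp [proj]

lemma proj_fix (S : Submodule ℂ H) (hS : IsClosed (S : Set H)) {x : H} (hx : x ∈ S) :
    proj S hS x = x := by
  haveI : CompleteSpace S := hS.completeSpace_coe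
  have := Submodule.starProjection_eq_self_iff (K := S) (v := x)
  exact this.2 hx

lemma isPr_proj (S : Submodule ℂ H) (hS : IsClosed (S : Set H)) : IsPr (proj S hS) := by
  refine ⟨fun x => ?_, fun x => proj_fix S hS (proj_mem S hS x)⟩
  haveI : CompleteSpace S := hS.completeSpace_coe
  have h : inner ℂ (proj S hS x) (x - proj S hS x) = 0 := by
    have := Submodule.sub_starProjection_mem_orthogonal (K := S) x
    exact (Submodule.mem_orthogonal S _).1 this _ (proj_mem S hS x)
  have h2 := norm_add_sq_eq_norm_sq_add_norm_sq_of_inner_eq_zero _ _ h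
  rw [add_sub_cancel] at h2
  nlinarith [h2]

lemma IsPr.norm_le {T : H →L[ℂ] H} (hT : IsPr T) (x : H) : ‖T x‖ ≤ ‖x‖ := by
  apply le_of_sq_le_sq _ (norm_nonneg _)
  nlinarith [hT.pyth x, sq_nonneg ‖x - T x‖]

lemma IsPr.best {T : H →L[ℂ] H} (hT : IsPr T) (x z : H) : ‖x - T x‖ ≤ ‖x - T z‖ := by
  apply le_of_sq_le_sq _ (norm_nonneg _)
  have h := hT.pyth (x - T z)
  have e : T (x - T z) = T x - T z := by rw [map_sub, hT.idem]
  rw [e, sub_sub_sub_cancel_right] at h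
  nlinarith [sq_nonneg ‖T x - T z‖]

lemma list_gap (L : List (H →L[ℂ] H)) (hL : ∀ T ∈ L, IsPr T) :
    ∃ C : ℝ, 0 < C ∧ ∀ y, ‖L.prod y‖ ≤ ‖y‖ ∧
      ‖y - L.prod y‖ ^ 2 ≤ C * (‖y‖ ^ 2 - ‖L.prod y‖ ^ 2) ∧
      ∀ T ∈ L, ‖y - T y‖ ^ 2 ≤ C * (‖y‖ ^ 2 - ‖L.prod y‖ ^ 2) := by
  induction L with
  | nil => exact ⟨1, one_pos, fun y => by simp⟩
  | cons T L ih =>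
    obtain ⟨C, hC, h⟩ := ih fun S hS => hL S (List.mem_cons_of_mem _ hS)
    have hT := hL T List.mem_cons_self
    refine ⟨2 * C + 2, by linarith, fun y => ?_⟩
    obtain ⟨h1, h2, h3⟩ := h y
    have e : (T :: L).prod y = T (L.prod y) := by simp
    rw [e]
    set z := L.prod y with hz
    have hp := hT.pyth z
    have hA : 0 ≤ ‖y‖ ^ 2 - ‖z‖ ^ 2 := by nlinarith [norm_nonneg z]
    have hB : 0 ≤ ‖z - T z‖ ^ 2 := sq_nonneg _
    have hgap : ‖y‖ ^ 2 - ‖T z‖ ^ 2 = (‖y‖ ^ 2 - ‖z‖ ^ 2) + ‖z - T z‖ ^ 2 := by linarith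
    have key : ‖y - T z‖ ^ 2 ≤ (2 * C + 2) * (‖y‖ ^ 2 - ‖T z‖ ^ 2) := by
      have t : ‖y - T z‖ ≤ ‖y - z‖ + ‖z - T z‖ := norm_sub_le_norm_sub_add_norm_sub _ _ _
      have t2 : ‖y - T z‖ ^ 2 ≤ 2 * ‖y - z‖ ^ 2 + 2 * ‖z - T z‖ ^ 2 := by
        nlinarith [norm_nonneg (y - T z), sq_nonneg (‖y - z‖ - ‖z - T z‖)]
      rw [hgap]
      nlinarith [mul_nonneg hC.le hB]
    refine ⟨(hT.norm_le z).trans h1, key, fun S hS => ?_⟩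
    rcases List.mem_cons.1 hS with rfl | hS
    · have := hT.best y z
      have : ‖y - S y‖ ^ 2 ≤ ‖y - S z‖ ^ 2 := by gcongr
      linarith
    · have := h3 S hS
      rw [hgap]
      nlinarith [mul_nonneg hC.le hB]

lemma list_disp (L : List (H →L[ℂ] H)) (hL : ∀ T ∈ L, IsPr T) (y : H) :
    ‖y - L.prod y‖ ≤ (L.map fun T => ‖y - T y‖).sum := by
  induction L with
  | nil => simp
  | cons T L ih =>
    have h := ih fun S hS => hL S (List.mem_cons_of_mem _ hS)
    have hT := hL T List.mem_cons_self
    have e : y - (T :: L).prod y = (y - T y) + T (y - L.prod y) := by simp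
    rw [e, List.map_cons, List.sum_cons]
    refine (norm_add_le _ _).trans ?_
    gcongr
    exact (hT.norm_le _).trans h

lemma list_fix (L : List (H →L[ℂ] H)) (x : H) (hL : ∀ T ∈ L, T x = x) : L.prod x = x := by
  induction L with
  | nil => simp
  | cons T L ih =>
    have h := ih fun S hS => hL S (List.mem_cons_of_mem _ hS)
    have hT := hL T List.mem_cons_self
    simp [h, hT]

lemma not_mem_of_norm {A : H →L[ℂ] H} (h : ‖A‖ < 1) : (1 : ℂ) ∉ spectrum ℂ A := by
  rw [spectrum.notMem_iff, map_one]
  exact isUnit_one_sub_of_norm_lt_one h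

lemma bdd_below_of {T P : H →L[ℂ] H} (h : (1 : ℂ) ∉ spectrum ℂ (T - P)) :
    ∃ c : ℝ, 0 < c ∧ ∀ y, P y = 0 → c * ‖y‖ ≤ ‖y - T y‖ := by
  rw [spectrum.notMem_iff, map_one] at h
  obtain ⟨u, hu⟩ := h
  set B : H →L[ℂ] H := ((u⁻¹ : (H →L[ℂ] H)ˣ) : H →L[ℂ] H)
  have hB : B * (1 - (T - P)) = 1 := by rw [← hu]; exact u.inv_mul
  refine ⟨(‖B‖ + 1)⁻¹, by positivity, fun y hy => ?_⟩
  have e : B (y - T y) = y := by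
    have := congrArg (fun A : H →L[ℂ] H => A y) hB
    simpa [hy] using this
  have h1 : ‖y‖ ≤ ‖B‖ * ‖y - T y‖ := by
    conv_lhs => rw [← e]
    exact B.le_opNorm _
  rw [inv_mul_le_iff₀ (by positivity)]
  nlinarith [norm_nonneg (y - T y)]

lemma norm_lt_of {T P : H →L[ℂ] H} (hP : IsPr P) (hTP : ∀ x, T (P x) = P x)
    {δ : ℝ} (hδ : 0 < δ) (h : ∀ y, P y = 0 → δ * ‖y‖ ^ 2 ≤ ‖y‖ ^ 2 - ‖T y‖ ^ 2) :
    ‖T - P‖ < 1 := by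
  set d := min δ 1
  have hd : 0 < d := lt_min hδ one_pos
  have hd1 : d ≤ 1 := min_le_right _ _
  have hb : ‖T - P‖ ≤ Real.sqrt (1 - d) := by
    refine ContinuousLinearMap.opNorm_le_bound _ (Real.sqrt_nonneg _) fun x => ?_
    have hy : P (x - P x) = 0 := by rw [map_sub, hP.idem, sub_self]
    have e : (T - P) x = T (x - P x) := by simp [hTP]
    have h1 := h _ hy
    have h2 : ‖x - P x‖ ^ 2 ≤ ‖x‖ ^ 2 := by nlinarith [hP.pyth x, sq_nonneg ‖P x‖]
    have h3 : d * ‖x - P x‖ ^ 2 ≤ δ * ‖x - P x‖ ^ 2 := by gcongr; exact min_le_left _ _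
    rw [e]
    apply le_of_sq_le_sq _ (by positivity)
    rw [mul_pow, Real.sq_sqrt (by linarith)]
    nlinarith [mul_le_mul_of_nonneg_left h2 (sub_nonneg.2 hd1)]
  refine hb.trans_lt ?_
  rw [Real.sqrt_lt' one_pos]
  linarith

/-- For closed proper subspaces `M₁, …, M_N` with intersection `M`: the
existence of one permutation/weight for which one of the three spectral conditions holds is
equivalent to all three conditions holding for every permutation and every choice of weights. -/
theorem exists_iff_forall_norm_conditions
    {N : ℕ} (hN : 2 ≤ N) (M : Fin N → Submodule ℂ H)
    (hMc : ∀ i, IsClosed ((M i : Set H))) (hMp : ∀ i, M i ≠ ⊤) :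
    (∃ ρ : Equiv.Perm (Fin N), ∃ w : Fin N → ℝ, (∀ i, 0 < w i) ∧ ∑ i, w i = 1 ∧
      ((1 : ℂ) ∉ spectrum ℂ
          ((List.ofFn fun i => proj (M (ρ i)) (hMc (ρ i))).prod
            - proj (⨅ i, M i) (isClosed_iInf hMc)) ∨
        ‖(List.ofFn fun i => proj (M (ρ i)) (hMc (ρ i))).prod
            - proj (⨅ i, M i) (isClosed_iInf hMc)‖ < 1 ∨
        ‖(∑ i, (w i : ℂ) • proj (M i) (hMc i)) - proj (⨅ i, M i) (isClosed_iInf hMc)‖ < 1)) ↔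
    (∀ ρ' : Equiv.Perm (Fin N), ∀ w' : Fin N → ℝ, (∀ i, 0 < w' i) → ∑ i, w' i = 1 →
      ((1 : ℂ) ∉ spectrum ℂ
          ((List.ofFn fun i => proj (M (ρ' i)) (hMc (ρ' i))).prod
            - proj (⨅ i, M i) (isClosed_iInf hMc)) ∧
        ‖(List.ofFn fun i => proj (M (ρ' i)) (hMc (ρ' i))).prod
            - proj (⨅ i, M i) (isClosed_iInf hMc)‖ < 1 ∧
        ‖(∑ i, (w' i : ℂ) • proj (M i) (hMc i)) - proj (⨅ i, M i) (isClosed_iInf hMc)‖ < 1)) := by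
  classical
  set P := proj (⨅ i, M i) (isClosed_iInf hMc) with hPdef
  have hP : IsPr P := isPr_proj _ _
  have hPi : ∀ i, IsPr (proj (M i) (hMc i)) := fun i => isPr_proj _ _
  have hfix : ∀ i x, proj (M i) (hMc i) (P x) = P x := fun i x =>
    proj_fix _ _ ((Submodule.mem_iInf _).1 (proj_mem _ _ x) i)
  have hN0 : (0 : ℝ) < N := by
    have : 0 < N := by omega
    exact_mod_cast this
  constructor
  · rintro ⟨ρ, w, hw, hw1, hcond⟩
    -- linear regularity
    have K : ∃ c : ℝ, 0 < c ∧ ∀ y, P y = 0 →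
        c * ‖y‖ ≤ ∑ i, ‖y - proj (M i) (hMc i) y‖ := by
      have hspec : (1 : ℂ) ∉ spectrum ℂ
          ((List.ofFn fun i => proj (M (ρ i)) (hMc (ρ i))).prod - P) ∨
          (1 : ℂ) ∉ spectrum ℂ ((∑ i, (w i : ℂ) • proj (M i) (hMc i)) - P) := by
        rcases hcond with h | h | h
        · exact Or.inl h
        · exact Or.inl (not_mem_of_norm h)
        · exact Or.inr (not_mem_of_norm h)
      rcases hspec with h | h
      · obtain ⟨c, hc, hb⟩ := bdd_below_of h
        refine ⟨c, hc, fun y hy => (hb y hy).trans ?_⟩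
        refine (list_disp _ ?_ y).trans ?_
        · intro T hT
          obtain ⟨i, rfl⟩ := (List.mem_ofFn' _ _).1 hT
          exact hPi _
        · rw [List.map_ofFn, List.sum_ofFn]
          exact (Equiv.sum_comp ρ fun i => ‖y - proj (M i) (hMc i) y‖).le
      · obtain ⟨c, hc, hb⟩ := bdd_below_of h
        refine ⟨c, hc, fun y hy => (hb y hy).trans ?_⟩
        have hw1' : ∑ i, (w i : ℂ) = 1 := by exact_mod_cast hw1
        have e : y - (∑ i, (w i : ℂ) • proj (M i) (hMc i)) y
            = ∑ i, (w i : ℂ) • (y - proj (M i) (hMc i) y) := by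
          simp only [smul_sub, Finset.sum_sub_distrib, ← Finset.sum_smul, hw1', one_smul]
          simp [ContinuousLinearMap.sum_apply]
        rw [e]
        refine (norm_sum_le _ _).trans (Finset.sum_le_sum fun i _ => ?_)
        rw [norm_smul, Complex.norm_real, Real.norm_of_nonneg (hw i).le]
        have : w i ≤ 1 := by
          rw [← hw1]
          exact Finset.single_le_sum (fun j _ => (hw j).le) (Finset.mem_univ i)
        exact mul_le_of_le_one_left (norm_nonneg _) this
    obtain ⟨c, hc, hK⟩ := K
    have hK2 : ∀ y, P y = 0 →
        c ^ 2 * ‖y‖ ^ 2 ≤ N * ∑ i, ‖y - proj (M i) (hMc i) y‖ ^ 2 := by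
      intro y hy
      have h1 : (c * ‖y‖) ^ 2 ≤ (∑ i, ‖y - proj (M i) (hMc i) y‖) ^ 2 := by
        have := hK y hy
        gcongr
      have h2 := sq_sum_le_card_mul_sum_sq (s := Finset.univ)
        (f := fun i => ‖y - proj (M i) (hMc i) y‖)
      rw [Finset.card_univ, Fintype.card_fin] at h2
      rw [← mul_pow]
      exact h1.trans h2
    intro ρ' w' hw' hw1'
    have hprod : ‖(List.ofFn fun i => proj (M (ρ' i)) (hMc (ρ' i))).prod - P‖ < 1 := by
      obtain ⟨C, hC, hg⟩ := list_gap (List.ofFn fun i => proj (M (ρ' i)) (hMc (ρ' i)))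
        (by
          intro T hT
          obtain ⟨i, rfl⟩ := (List.mem_ofFn' _ _).1 hT
          exact hPi _)
      refine norm_lt_of hP (fun x => ?_) (δ := c ^ 2 / (N * (N * C))) (by positivity) ?_
      · refine list_fix _ _ fun T hT => ?_
        obtain ⟨i, rfl⟩ := (List.mem_ofFn' _ _).1 hT
        exact hfix _ _
      · intro y hy
        have h3 := (hg y).2.2
        set G := ‖y‖ ^ 2 - ‖(List.ofFn fun i => proj (M (ρ' i)) (hMc (ρ' i))).prod y‖ ^ 2
        have h4 : ∑ i, ‖y - proj (M i) (hMc i) y‖ ^ 2 ≤ ∑ _i : Fin N, C * G := by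
          refine Finset.sum_le_sum fun i _ => h3 _ ?_
          rw [List.mem_ofFn']
          exact ⟨ρ'.symm i, by simp⟩
        rw [Finset.sum_const, Finset.card_univ, Fintype.card_fin, nsmul_eq_mul] at h4
        have h5 := hK2 y hy
        have h6 := mul_le_mul_of_nonneg_left h4 hN0.le
        rw [div_mul_eq_mul_div, div_le_iff₀ (by positivity)]
        linarith
    refine ⟨not_mem_of_norm hprod, hprod, ?_⟩
    haveI : Nonempty (Fin N) := ⟨⟨0, by omega⟩⟩
    obtain ⟨i0, hi0⟩ := Finite.exists_min w'
    have hw1c : ∑ i, (w' i : ℂ) = 1 := by exact_mod_cast hw1'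
    have happ : ∀ y, (∑ i, (w' i : ℂ) • proj (M i) (hMc i)) y
        = ∑ i, (w' i : ℂ) • proj (M i) (hMc i) y := fun y => by
      simp [ContinuousLinearMap.sum_apply]
    have hpos := hw' i0
    refine norm_lt_of hP (fun x => ?_) (δ := w' i0 * c ^ 2 / N) (by positivity) ?_
    · rw [happ]
      simp only [hfix, ← Finset.sum_smul, hw1c, one_smul]
    · intro y hy
      have h1 : ‖(∑ i, (w' i : ℂ) • proj (M i) (hMc i)) y‖
          ≤ ∑ i, w' i * ‖proj (M i) (hMc i) y‖ := by
        rw [happ]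
        refine (norm_sum_le _ _).trans (Finset.sum_le_sum fun i _ => ?_)
        rw [norm_smul, Complex.norm_real, Real.norm_of_nonneg (hw' i).le]
      have h2 : (∑ i, w' i * ‖proj (M i) (hMc i) y‖) ^ 2
          ≤ ∑ i, w' i * ‖proj (M i) (hMc i) y‖ ^ 2 :=
        Real.pow_arith_mean_le_arith_mean_pow _ _ _ (fun i _ => (hw' i).le) hw1'
          (fun i _ => norm_nonneg _) 2
      have h3 : ∑ i, w' i * ‖proj (M i) (hMc i) y‖ ^ 2
          = ‖y‖ ^ 2 - ∑ i, w' i * ‖y - proj (M i) (hMc i) y‖ ^ 2 := by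
        rw [eq_sub_iff_add_eq, ← Finset.sum_add_distrib]
        simp only [← mul_add, (hPi _).pyth, ← Finset.sum_mul, hw1', one_mul]
      have h4 : w' i0 * ∑ i, ‖y - proj (M i) (hMc i) y‖ ^ 2
          ≤ ∑ i, w' i * ‖y - proj (M i) (hMc i) y‖ ^ 2 := by
        rw [Finset.mul_sum]
        exact Finset.sum_le_sum fun i _ => mul_le_mul_of_nonneg_right (hi0 i) (sq_nonneg _)
      have h5 := mul_le_mul_of_nonneg_left (hK2 y hy) hpos.le
      have h6 : ‖(∑ i, (w' i : ℂ) • proj (M i) (hMc i)) y‖ ^ 2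
          ≤ (∑ i, w' i * ‖proj (M i) (hMc i) y‖) ^ 2 := by gcongr
      have h7 : w' i0 * c ^ 2 / N * ‖y‖ ^ 2 ≤ w' i0 * ∑ i, ‖y - proj (M i) (hMc i) y‖ ^ 2 := by
        rw [div_mul_eq_mul_div, div_le_iff₀ hN0]
        linarith
      linarith
  · intro h
    have hs : ∑ _i : Fin N, (1 / N : ℝ) = 1 := by
      rw [Finset.sum_const, Finset.card_univ, Fintype.card_fin, nsmul_eq_mul]
      field_simp
    refine ⟨1, fun _ => 1 / N, fun _ => by positivity, hs, Or.inl ?_⟩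
    exact (h 1 (fun _ => 1 / N) (fun _ => by positivity) hs).1
end

section
/- Let g ≥ 1 and let F₁,…,F_g be closed subspaces of a complex Hilbert space H. Let f ∈ H with f ≠ 0 and let λ ∈ ℂ with |λ| = 1. If P_{F₁}P_{F₂}⋯P_{F_g} f = λ f, then f ∈ ⋂_{d=1}^g F_d and λ = 1. -/
set_option linter.unusedSectionVars false

variable {H : Type*} [NormedAddCommGroup H] [InnerProductSpace ℂ H] [CompleteSpace H]

theorem proj_norm_le (S : Submodule ℂ H) (hS : IsClosed (S : Set H)) (v : H) :
    ‖proj S hS v‖ ≤ ‖v‖ := by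
  haveI : CompleteSpace S := hS.completeSpace_coe
  exact S.norm_starProjection_apply_le v

theorem proj_of_norm (S : Submodule ℂ H) (hS : IsClosed (S : Set H)) (v : H)
    (h : ‖v‖ ≤ ‖proj S hS v‖) : v ∈ S := by
  haveI : CompleteSpace S := hS.completeSpace_coe
  exact (S.mem_iff_norm_starProjection v).2 (le_antisymm (S.norm_starProjection_apply_le v) h)

theorem proj_of_mem (S : Submodule ℂ H) (hS : IsClosed (S : Set H)) (v : H)
    (h : v ∈ S) : proj S hS v = v := by
  haveI : CompleteSpace S := hS.completeSpace_coe
  exact Submodule.starProjection_eq_self_iff.2 h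

theorem prod_proj_aux (f : H) : ∀ {g : ℕ} (F : Fin g → Submodule ℂ H)
    (hF : ∀ d, IsClosed ((F d : Set H))),
    ‖(List.ofFn fun d => proj (F d) (hF d)).prod f‖ ≤ ‖f‖ ∧
    (‖f‖ ≤ ‖(List.ofFn fun d => proj (F d) (hF d)).prod f‖ →
      (∀ d, f ∈ F d) ∧ (List.ofFn fun d => proj (F d) (hF d)).prod f = f) := by
  intro g
  induction g with
  | zero => intro F hF; simp
  | succ n ih =>
    intro F hF
    obtain ⟨h1, h2⟩ := ih (fun d => F d.succ) (fun d => hF d.succ)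
    rw [List.ofFn_succ, List.prod_cons, ContinuousLinearMap.mul_apply]
    have h3 := proj_norm_le (F 0) (hF 0)
      ((List.ofFn fun d : Fin n => proj (F d.succ) (hF d.succ)).prod f)
    refine ⟨h3.trans h1, fun h => ?_⟩
    obtain ⟨h4, h5⟩ := h2 (h.trans h3)
    rw [h5] at h ⊢
    have h6 := proj_of_norm _ _ _ h
    exact ⟨fun d => Fin.cases h6 h4 d, proj_of_mem _ _ _ h6⟩

/-- A product of orthogonal projections has no eigenvalue of modulus one
other than `1`, and any corresponding eigenvector lies in the intersection of the subspaces. -/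
theorem eigenvector_of_prod_projections
    {g : ℕ} (hg : 1 ≤ g) (F : Fin g → Submodule ℂ H)
    (hF : ∀ d, IsClosed ((F d : Set H)))
    (f : H) (hf : f ≠ 0) (lam : ℂ) (hlam : ‖lam‖ = 1)
    (heig : (List.ofFn fun d => proj (F d) (hF d)).prod f = lam • f) :
    f ∈ ⨅ d, F d ∧ lam = 1 := by
  obtain ⟨h1, h2⟩ := (prod_proj_aux f F hF).2 (by rw [heig, norm_smul, hlam, one_mul])
  refine ⟨(Submodule.mem_iInf _).2 h1, ?_⟩
  rw [heig] at h2
  exact smul_left_injective ℂ hf (by simpa using h2)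
end
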